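/- Let $K = [x_c - h_x, x_c + h_x] \times [y_c - h_y, y_c + h_y]$ with $h_x, h_y > 0$, let $u \in P_4$, and let $p \in Q_{Ad}$ be an Adini interpolant of $u$ on $K$. Writing $\xi = (x - x_c)/h_x$ and $\eta = (y - y_c)/h_y$, and denoting by $u_{xxxx}$, $u_{xxyy}$ the (constant) derivatives $\partial^4 u/\partial x^4$ and $\partial^4 u/\partial x^2 \partial y^2$, one has the identity of polynomials $\frac{\partial^2 (u - p)}{\partial x^2} = \frac{h_x^2}{24}\, u_{xxxx}\, (12\xi^2 - 4) + \frac{h_y^2}{2}\, u_{xxyy}\, (\eta^2 - 1)$. -/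

import Mathlib

open MvPolynomial

/-- The Adini shape space `Q_Ad = P₃ + span{x³y, xy³}` as a set of real
polynomials in two variables (`X 0` is `x`, `X 1` is `y`). -/
def QAd : Set (MvPolynomial (Fin 2) ℝ) :=
  {p | ∃ q : MvPolynomial (Fin 2) ℝ, ∃ c₁ c₂ : ℝ, q.totalDegree ≤ 3 ∧
    p = q + C c₁ * (X 0 ^ 3 * X 1) + C c₂ * (X 0 * X 1 ^ 3)}

lemma pderiv_ofNat {R σ : Type*} [CommSemiring R] (i : σ) (n : ℕ) [n.AtLeastTwo] :
    pderiv i (ofNat(n) : MvPolynomial σ R) = 0 :=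
  (pderiv i).map_natCast n

/-- A bivariate polynomial of total degree at most `n` is the sum of its terms of degree `≤ n`. -/
lemma eq_sum_antidiagonal_of_totalDegree_le {R : Type*} [CommSemiring R] {n : ℕ}
    {q : MvPolynomial (Fin 2) R} (hq : q.totalDegree ≤ n) :
    q = ∑ k ∈ Finset.range (n + 1), ∑ ij ∈ Finset.HasAntidiagonal.antidiagonal k,
      C (coeff (Finsupp.single 0 ij.1 + Finsupp.single 1 ij.2) q) *
        (X 0 ^ ij.1 * X 1 ^ ij.2) := by
  have hexp (m : Fin 2 →₀ ℕ) : Finsupp.single 0 (m 0) + Finsupp.single 1 (m 1) = m := by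
    ext i; fin_cases i <;> simp
  have hmon (m : Fin 2 →₀ ℕ) (a : R) :
      monomial m a = C a * (X 0 ^ m 0 * X 1 ^ m 1) := by
    rw [monomial_eq, Finsupp.prod_fintype _ _ (by simp), Fin.prod_univ_two]
  rw [Finset.sum_sigma']
  conv_lhs => rw [q.as_sum]
  refine Finset.sum_of_injOn (fun m => ⟨m 0 + m 1, (m 0, m 1)⟩) ?_ ?_ ?_ ?_
  · intro m _ m' _ h
    simp only [Sigma.mk.injEq] at h
    have h2 := eq_of_heq h.2
    simp only [Prod.mk.injEq] at h2
    rw [← hexp m, ← hexp m', h2.1, h2.2]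
  · intro m hm
    have hle := (le_totalDegree hm).trans hq
    rw [Finsupp.sum_fintype _ _ (by simp), Fin.sum_univ_two] at hle
    simpa [Nat.lt_succ_iff] using hle
  · rintro ⟨k, i, j⟩ hk hnot
    simp only [Finset.mem_sigma, Finset.HasAntidiagonal.mem_antidiagonal] at hk
    have hzero : coeff (Finsupp.single 0 i + Finsupp.single 1 j) q = 0 := by
      by_contra h
      refine hnot ⟨_, mem_support_iff.mpr h, ?_⟩
      simp [hk.2]
    simp [hzero]
  · intro m _
    simp only [hexp, hmon]

lemma totalDegree_aeval_le_of_totalDegree_le_one {R σ τ : Type*} [CommSemiring R]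
    {f : σ → MvPolynomial τ R} (hf : ∀ i, (f i).totalDegree ≤ 1) (q : MvPolynomial σ R) :
    (aeval f q).totalDegree ≤ q.totalDegree := by
  rw [aeval_def, eval₂_eq]
  refine totalDegree_finsetSum_le fun m hm => ?_
  refine (totalDegree_mul _ _).trans ?_
  rw [algebraMap_eq, totalDegree_C, zero_add]
  refine (totalDegree_finsetProd _ _).trans (le_trans ?_ (le_totalDegree hm))
  refine Finset.sum_le_sum fun i _ => (totalDegree_pow _ _).trans ?_
  simpa using Nat.mul_le_mul_left (m i) (hf i)

/-- Expansion of a bivariate polynomial in powers of rescaled coordinates. -/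
lemma exists_eq_sum_affine {K : Type*} [Field K] {n : ℕ} {a b h k : K} (hh : h ≠ 0)
    (hk : k ≠ 0) {q : MvPolynomial (Fin 2) K} (hq : q.totalDegree ≤ n) :
    ∃ c : ℕ → ℕ → K, q = ∑ d ∈ Finset.range (n + 1), ∑ ij ∈ Finset.HasAntidiagonal.antidiagonal d,
      C (c ij.1 ij.2) * ((C h⁻¹ * (X 0 - C a)) ^ ij.1 * (C k⁻¹ * (X 1 - C b)) ^ ij.2) := by
  let f : Fin 2 → MvPolynomial (Fin 2) K := ![C a + C h * X 0, C b + C k * X 1]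
  let g : Fin 2 → MvPolynomial (Fin 2) K := ![C h⁻¹ * (X 0 - C a), C k⁻¹ * (X 1 - C b)]
  have hdeg (r s : K) (i : Fin 2) : (C r + C s * X i : MvPolynomial (Fin 2) K).totalDegree ≤ 1 := by
    refine (totalDegree_add _ _).trans (max_le (by simp) ((totalDegree_mul _ _).trans ?_))
    simp
  have hf (i : Fin 2) : (f i).totalDegree ≤ 1 := by
    fin_cases i <;> simp only [f] <;> exact hdeg _ _ _
  have hfg : aeval g (aeval f q) = q := by
    have hcancel {r : K} (hr : r ≠ 0) : (C r * C r⁻¹ : MvPolynomial (Fin 2) K) = 1 := by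
      rw [← C_mul, mul_inv_cancel₀ hr, C_1]
    have hcomp : (aeval g).comp (aeval f) = AlgHom.id K (MvPolynomial (Fin 2) K) := by
      ext1 i
      fin_cases i
      · simp [f, g, ← mul_assoc, hcancel hh]
      · simp [f, g, ← mul_assoc, hcancel hk]
    exact DFunLike.congr_fun hcomp q
  have hexp := eq_sum_antidiagonal_of_totalDegree_le
    ((totalDegree_aeval_le_of_totalDegree_le_one hf q).trans hq)
  refine ⟨fun i j => coeff (Finsupp.single 0 i + Finsupp.single 1 j) (aeval f q), ?_⟩
  have := congrArg (aeval g) hexp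
  rw [hfg] at this
  simpa [g, map_sum] using this

lemma totalDegree_le_four_of_mem_QAd {p : MvPolynomial (Fin 2) ℝ} (hp : p ∈ QAd) :
    p.totalDegree ≤ 4 := by
  obtain ⟨q, c₁, c₂, hq, rfl⟩ := hp
  have hmul (c : ℝ) (i j : ℕ) (hij : i + j ≤ 4) :
      (C c * (X 0 ^ i * X 1 ^ j) : MvPolynomial (Fin 2) ℝ).totalDegree ≤ 4 := by
    refine (totalDegree_mul _ _).trans ?_
    have := totalDegree_mul (X 0 ^ i : MvPolynomial (Fin 2) ℝ) (X 1 ^ j)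
    simp only [totalDegree_X_pow] at this
    simp only [totalDegree_C]
    omega
  refine (totalDegree_add _ _).trans (max_le ((totalDegree_add _ _).trans (max_le ?_ ?_)) ?_)
  · omega
  · simpa using hmul c₁ 3 1 (by norm_num)
  · simpa using hmul c₂ 1 3 (by norm_num)

lemma pderiv_zero_four_eq_zero_of_mem_QAd {p : MvPolynomial (Fin 2) ℝ} (hp : p ∈ QAd) :
    pderiv 0 (pderiv 0 (pderiv 0 (pderiv 0 p))) = 0 := by
  obtain ⟨q, c₁, c₂, hq, rfl⟩ := hp
  rw [eq_sum_antidiagonal_of_totalDegree_le hq]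
  simp [Finset.sum_range_succ, Finset.Nat.antidiagonal_succ, Derivation.leibniz_pow, pderiv_X,
    pderiv_ofNat]

lemma pderiv_mixed_four_eq_zero_of_mem_QAd {p : MvPolynomial (Fin 2) ℝ} (hp : p ∈ QAd) :
    pderiv 0 (pderiv 0 (pderiv 1 (pderiv 1 p))) = 0 := by
  obtain ⟨q, c₁, c₂, hq, rfl⟩ := hp
  rw [eq_sum_antidiagonal_of_totalDegree_le hq]
  simp [Finset.sum_range_succ, Finset.Nat.antidiagonal_succ, Derivation.leibniz_pow, pderiv_X,
    pderiv_ofNat]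

/-- For `u ∈ P₄` and `p ∈ Q_Ad` an Adini interpolant of `u` on the rectangle
`K = [x_c-h_x, x_c+h_x] × [y_c-h_y, y_c+h_y]`, writing `ξ = (x-x_c)/h_x` and
`η = (y-y_c)/h_y`, one has
`(u-p)_xx = (h_x²/24) u_xxxx (12ξ² - 4) + (h_y²/2) u_xxyy (η² - 1)`. -/
theorem adini_error_second_derivative_xx (xc yc hx hy : ℝ)
    (hhx : 0 < hx) (hhy : 0 < hy)
    (u p : MvPolynomial (Fin 2) ℝ) (hu : u.totalDegree ≤ 4) (hp : p ∈ QAd)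
    (hval : ∀ s ∈ ({-1, 1} : Set ℝ), ∀ t ∈ ({-1, 1} : Set ℝ),
      eval ![xc + s * hx, yc + t * hy] p = eval ![xc + s * hx, yc + t * hy] u)
    (hgrad : ∀ s ∈ ({-1, 1} : Set ℝ), ∀ t ∈ ({-1, 1} : Set ℝ),
      eval ![xc + s * hx, yc + t * hy] (pderiv 0 p) =
        eval ![xc + s * hx, yc + t * hy] (pderiv 0 u) ∧
      eval ![xc + s * hx, yc + t * hy] (pderiv 1 p) =
        eval ![xc + s * hx, yc + t * hy] (pderiv 1 u)) :
    pderiv 0 (pderiv 0 (u - p)) =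
      C (hx ^ 2 / 24) * (pderiv 0 (pderiv 0 (pderiv 0 (pderiv 0 u)))) *
        (12 * (C hx⁻¹ * (X 0 - C xc)) ^ 2 - 4) +
      C (hy ^ 2 / 2) * (pderiv 0 (pderiv 0 (pderiv 1 (pderiv 1 u)))) *
        ((C hy⁻¹ * (X 1 - C yc)) ^ 2 - 1) := by
  have hx0 : hx ≠ 0 := hhx.ne'
  have hy0 : hy ≠ 0 := hhy.ne'
  have hdeg : (u - p).totalDegree ≤ 4 :=
    (totalDegree_sub _ _).trans (max_le hu (totalDegree_le_four_of_mem_QAd hp))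
  have hxxxx : pderiv 0 (pderiv 0 (pderiv 0 (pderiv 0 u))) =
      pderiv 0 (pderiv 0 (pderiv 0 (pderiv 0 (u - p)))) := by
    simp [pderiv_zero_four_eq_zero_of_mem_QAd hp]
  have hxxyy : pderiv 0 (pderiv 0 (pderiv 1 (pderiv 1 u))) =
      pderiv 0 (pderiv 0 (pderiv 1 (pderiv 1 (u - p)))) := by
    simp [pderiv_mixed_four_eq_zero_of_mem_QAd hp]
  have hvalue (s : ℝ) (hs : s ∈ ({-1, 1} : Set ℝ)) (t : ℝ) (ht : t ∈ ({-1, 1} : Set ℝ)) :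
      eval ![xc + s * hx, yc + t * hy] (u - p) = 0 := by
    simp [hval s hs t ht]
  have hderiv (s : ℝ) (hs : s ∈ ({-1, 1} : Set ℝ)) (t : ℝ) (ht : t ∈ ({-1, 1} : Set ℝ)) :
      eval ![xc + s * hx, yc + t * hy] (pderiv 0 (u - p)) = 0 ∧
        eval ![xc + s * hx, yc + t * hy] (pderiv 1 (u - p)) = 0 := by
    simp [hgrad s hs t ht]
  rw [hxxxx, hxxyy]
  clear hxxxx hxxyy hval hgrad hu hp
  generalize u - p = e at *
  obtain ⟨c, rfl⟩ := exists_eq_sum_affine (a := xc) (b := yc) hx0 hy0 hdeg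
  clear hdeg
  have hcancel {h : ℝ} (hh : h ≠ 0) (s : ℝ) : h⁻¹ * (s * h) = s := by field_simp
  have hvalue' (s : ℝ) (hs : s ∈ ({-1, 1} : Set ℝ)) (t : ℝ) (ht : t ∈ ({-1, 1} : Set ℝ)) :
      ∑ d ∈ Finset.range 5, ∑ ij ∈ Finset.HasAntidiagonal.antidiagonal d,
        c ij.1 ij.2 * (s ^ ij.1 * t ^ ij.2) = 0 := by
    simpa [map_sum, hcancel hx0, hcancel hy0] using hvalue s hs t ht
  have hderiv' (s : ℝ) (hs : s ∈ ({-1, 1} : Set ℝ)) (t : ℝ) (ht : t ∈ ({-1, 1} : Set ℝ)) :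
      ∑ d ∈ Finset.range 5, ∑ ij ∈ Finset.HasAntidiagonal.antidiagonal d,
          c ij.1 ij.2 * (ij.1 * s ^ (ij.1 - 1) * t ^ ij.2) = 0 ∧
        ∑ d ∈ Finset.range 5, ∑ ij ∈ Finset.HasAntidiagonal.antidiagonal d,
          c ij.1 ij.2 * (s ^ ij.1 * (ij.2 * t ^ (ij.2 - 1))) = 0 := by
    obtain ⟨h0, h1⟩ := hderiv s hs t ht
    constructor
    · apply mul_right_cancel₀ (inv_ne_zero hx0)
      rw [zero_mul, ← h0]
      simp only [Finset.sum_mul, map_sum]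
      refine Finset.sum_congr rfl fun d _ => Finset.sum_congr rfl fun ij _ => ?_
      simp [Derivation.leibniz_pow, pderiv_X, hcancel hx0, hcancel hy0]
      ring
    · apply mul_right_cancel₀ (inv_ne_zero hy0)
      rw [zero_mul, ← h1]
      simp only [Finset.sum_mul, map_sum]
      refine Finset.sum_congr rfl fun d _ => Finset.sum_congr rfl fun ij _ => ?_
      simp [Derivation.leibniz_pow, pderiv_X, hcancel hx0, hcancel hy0]
      ring
  clear hvalue hderiv
  simp [Finset.sum_range_succ, Finset.Nat.antidiagonal_succ] at hvalue' hderiv'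
  have h30 : c 3 0 = 0 := by linarith
  have h21 : c 2 1 = 0 := by linarith
  have h31 : c 3 1 = 0 := by linarith
  have h20 : c 2 0 = - 2 * c 4 0 - c 2 2 := by linarith
  apply MvPolynomial.funext
  intro z
  simp [Finset.sum_range_succ, Finset.Nat.antidiagonal_succ, Derivation.leibniz_pow, pderiv_X,
    pderiv_ofNat, h30, h21, h31, h20]
  field_simp
  ring
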